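/- There is no binary map f : {0,1,3}×{0,1,3} → {0,1,3} that preserves each of S1, S2, S3, S4 and satisfies f(1,1)=1, f(3,3)=3, f(1,3)=f(3,1), and f(1,3)∈{1,3}. In particular, no binary polymorphism of the structure D restricts to a semilattice operation on the two-element set {1,3}. -/

import Mathlib

namespace Paper

/-- The relation `S1 = {(0,3),(1,1),(3,1),(3,3)}`. -/
def S1 : Set (ℕ × ℕ) := {(0, 3), (1, 1), (3, 1), (3, 3)}

/-- The relation `S2 = {(1,0),(1,1),(3,1),(3,3)}`. -/
def S2 : Set (ℕ × ℕ) := {(1, 0), (1, 1), (3, 1), (3, 3)}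

/-- The relation `S3 = {(1,3),(3,1),(3,3)}`. -/
def S3 : Set (ℕ × ℕ) := {(1, 3), (3, 1), (3, 3)}

/-- The relation `S4 = {(1,1),(1,3),(3,1)}`. -/
def S4 : Set (ℕ × ℕ) := {(1, 1), (1, 3), (3, 1)}

/-- The domain `{0,1,3}` of the structure `D`. -/
def Dom : Set ℕ := {0, 1, 3}

/-- No binary map on `{0,1,3}` preserving `S1, S2, S3, S4` satisfies
`f(1,1)=1`, `f(3,3)=3`, `f(1,3)=f(3,1)` and `f(1,3) ∈ {1,3}`; in particular no
binary polymorphism of `D` restricts to a semilattice operation on `{1,3}`. -/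
theorem stmt1 :
    ¬ ∃ f : ℕ → ℕ → ℕ,
      (∀ a ∈ Dom, ∀ b ∈ Dom, f a b ∈ Dom) ∧
      (∀ a b a' b' : ℕ, (a, b) ∈ S1 → (a', b') ∈ S1 → (f a a', f b b') ∈ S1) ∧
      (∀ a b a' b' : ℕ, (a, b) ∈ S2 → (a', b') ∈ S2 → (f a a', f b b') ∈ S2) ∧
      (∀ a b a' b' : ℕ, (a, b) ∈ S3 → (a', b') ∈ S3 → (f a a', f b b') ∈ S3) ∧
      (∀ a b a' b' : ℕ, (a, b) ∈ S4 → (a', b') ∈ S4 → (f a a', f b b') ∈ S4) ∧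
      f 1 1 = 1 ∧ f 3 3 = 3 ∧ f 1 3 = f 3 1 ∧ f 1 3 ∈ ({1, 3} : Set ℕ) := by
  rintro ⟨f, -, -, -, h3, h4, -, -, hcomm, -⟩
  -- Both `S3` and `S4` contain `(1, 3)` and `(3, 1)`, so both contain `(f 1 3, f 3 1)`.
  have hS3 := h3 1 3 3 1 (by simp [S3]) (by simp [S3])
  have hS4 := h4 1 3 3 1 (by simp [S4]) (by simp [S4])
  simp only [S3, S4, Set.mem_insert_iff, Set.mem_singleton_iff, Prod.mk.injEq] at hS3 hS4
  omega

end Paper
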